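/- arXiv:1611.09168 — 6 statements merged into one kernel-verified Lean document; each statement's English description precedes it below -/
import Mathlib

section
/- Strong duality for the min-max problem (Lemma 1): the dual optimal value q* := sup_{μ ∈ Δ} Σ_{i=1}^N q^i(μ) and the primal optimal value P* are both finite and satisfy q* = P*. -/
open Finset Filter Topology

noncomputable section

/-- The unit simplex in `ℝ^S`. -/
def unitSimplex (S : ℕ) : Set (Fin S → ℝ) :=
  {μ | (∀ s, 0 ≤ μ s) ∧ ∑ s, μ s = 1}

/-- The local dual function `q^i(μ) = inf_{x ∈ X^i} Σ_s μ_s g^i_s(x_s)`. -/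
def dualFn {N S : ℕ} (X : Fin N → Set (Fin S → ℝ))
    (g : Fin N → Fin S → ℝ → ℝ) (i : Fin N) (μ : Fin S → ℝ) : ℝ :=
  sInf ((fun x : Fin S → ℝ => ∑ s, μ s * g i s (x s)) '' X i)

/-- The set of achievable primal (min-max) values. -/
def primalSet {N S : ℕ} (X : Fin N → Set (Fin S → ℝ))
    (g : Fin N → Fin S → ℝ → ℝ) : Set ℝ :=
  {P | ∃ x : Fin N → Fin S → ℝ, (∀ i, x i ∈ X i) ∧
    P = ⨆ s : Fin S, ∑ i, g i s (x i s)}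

/-- The set of achievable dual values `Σ_i q^i(μ)`, `μ ∈ Δ`. -/
def dualSet {N S : ℕ} (X : Fin N → Set (Fin S → ℝ))
    (g : Fin N → Fin S → ℝ → ℝ) : Set ℝ :=
  {v | ∃ μ ∈ unitSimplex S, v = ∑ i, dualFn X g i μ}

/-- The local dual function is an attained minimum when `X i` is compact and nonempty. -/
lemma exists_dualFn_isLeast {N S : ℕ} {X : Fin N → Set (Fin S → ℝ)}
    {g : Fin N → Fin S → ℝ → ℝ} {i : Fin N} (hne : (X i).Nonempty) (hcomp : IsCompact (X i))
    (hg : ∀ s, Continuous (g i s)) (μ : Fin S → ℝ) :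
    ∃ x ∈ X i, dualFn X g i μ = ∑ s, μ s * g i s (x s) ∧
      ∀ y ∈ X i, dualFn X g i μ ≤ ∑ s, μ s * g i s (y s) := by
  have hcont : Continuous fun x : Fin S → ℝ => ∑ s, μ s * g i s (x s) := by fun_prop
  obtain ⟨x, hx, hmin⟩ := hcomp.exists_isMinOn hne hcont.continuousOn
  have heq : dualFn X g i μ = ∑ s, μ s * g i s (x s) :=
    IsLeast.csInf_eq ⟨Set.mem_image_of_mem _ hx, Set.forall_mem_image.2 fun y hy => hmin hy⟩
  exact ⟨x, hx, heq, fun y hy => heq.trans_le (hmin hy)⟩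

lemma sum_mul_le_iSup {S : ℕ} {μ : Fin S → ℝ} (hμ : μ ∈ unitSimplex S) (v : Fin S → ℝ) :
    ∑ s, μ s * v s ≤ ⨆ s, v s := by
  calc ∑ s, μ s * v s ≤ ∑ s, μ s * ⨆ t, v t := by
        gcongr with s
        · exact hμ.1 s
        · exact le_ciSup (Set.finite_range v).bddAbove s
    _ = ⨆ s, v s := by rw [← Finset.sum_mul, hμ.2, one_mul]

lemma sum_sum_mul_eq {N S : ℕ} (μ : Fin S → ℝ) (v : Fin N → Fin S → ℝ) :
    ∑ i, ∑ s, μ s * v i s = ∑ s, μ s * ∑ i, v i s := by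
  rw [Finset.sum_comm]
  simp only [Finset.mul_sum]

/-- The Lagrangian of the min-max problem has a saddle point. -/
lemma exists_isSaddlePointOn_lagrangian {N S : ℕ} (hS : 0 < S)
    {X : Fin N → Set (Fin S → ℝ)} (hXne : ∀ i, (X i).Nonempty)
    (hXconv : ∀ i, Convex ℝ (X i)) (hXcomp : ∀ i, IsCompact (X i))
    {g : Fin N → Fin S → ℝ → ℝ} (hg : ∀ i s, ConvexOn ℝ Set.univ (g i s)) :
    ∃ a ∈ Set.univ.pi X, ∃ b ∈ unitSimplex S,
      IsSaddlePointOn (Set.univ.pi X) (unitSimplex S)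
        (fun (x : Fin N → Fin S → ℝ) (μ : Fin S → ℝ) => ∑ s, μ s * ∑ i, g i s (x i s)) a b := by
  have hcont (i s) : Continuous (g i s) := (hg i s).locallyLipschitz.continuous
  have hconv : Convex ℝ (unitSimplex S) := convex_stdSimplex ℝ (Fin S)
  have hXpi : Convex ℝ (Set.univ.pi X) := convex_pi fun i _ => hXconv i
  apply Sion.exists_isSaddlePointOn (Set.univ_pi_nonempty_iff.2 hXne) hXpi
    (isCompact_univ_pi hXcomp) _ _ hconv
    ⟨_, single_mem_stdSimplex ℝ (⟨0, hS⟩ : Fin S)⟩ (isCompact_stdSimplex ℝ (Fin S))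
  · intro x _
    exact (show Continuous _ by fun_prop).upperSemicontinuous.upperSemicontinuousOn _
  · intro x _
    apply ConcaveOn.quasiconcaveOn
    refine ⟨hconv, fun μ _ ν _ c d _ _ _ => le_of_eq ?_⟩
    simp only [smul_eq_mul, Finset.mul_sum (s := Finset.univ (α := Fin S)),
      ← Finset.sum_add_distrib, Pi.add_apply, Pi.smul_apply]
    exact Finset.sum_congr rfl fun s _ => by ring
  · intro μ _
    exact (show Continuous _ by fun_prop).lowerSemicontinuous.lowerSemicontinuousOn _
  · intro μ hμ
    apply ConvexOn.quasiconvexOn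
    refine ⟨hXpi, fun x _ y _ c d hc hd hcd => ?_⟩
    calc ∑ s, μ s * ∑ i, g i s ((c • x + d • y) i s)
        ≤ ∑ s, μ s * ∑ i, (c * g i s (x i s) + d * g i s (y i s)) := by
          gcongr with s _ i
          · exact hμ.1 s
          · exact (hg i s).2 (Set.mem_univ _) (Set.mem_univ _) hc hd hcd
      _ = _ := by
          simp only [smul_eq_mul, Finset.mul_sum (s := Finset.univ (α := Fin S)),
            ← Finset.sum_add_distrib]
          refine Finset.sum_congr rfl fun s _ => ?_
          rw [Finset.sum_add_distrib, ← Finset.mul_sum, ← Finset.mul_sum]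
          ring

/-- Strong duality (Lemma 1): both the primal value `P* = sInf (primalSet X g)` and the
dual value `q* = sSup (dualSet X g)` are finite and coincide. -/
theorem strong_duality_minmax (N S : ℕ) (hN : 0 < N) (hS : 0 < S)
    (X : Fin N → Set (Fin S → ℝ))
    (hXne : ∀ i, (X i).Nonempty)
    (hXconv : ∀ i, Convex ℝ (X i))
    (hXcomp : ∀ i, IsCompact (X i))
    (g : Fin N → Fin S → ℝ → ℝ)
    (hg : ∀ i s, ConvexOn ℝ Set.univ (g i s)) :
    BddBelow (primalSet X g) ∧ (primalSet X g).Nonempty ∧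
    BddAbove (dualSet X g) ∧ (dualSet X g).Nonempty ∧
    sSup (dualSet X g) = sInf (primalSet X g) := by
  have hcont (i s) : Continuous (g i s) := (hg i s).locallyLipschitz.continuous
  have : Nonempty (Fin S) := ⟨⟨0, hS⟩⟩
  have weak : ∀ v ∈ dualSet X g, ∀ P ∈ primalSet X g, v ≤ P := by
    rintro _ ⟨μ, hμ, rfl⟩ _ ⟨x, hx, rfl⟩
    calc ∑ i, dualFn X g i μ ≤ ∑ i, ∑ s, μ s * g i s (x i s) := by
          gcongr with i
          obtain ⟨_, _, _, hle⟩ := exists_dualFn_isLeast (hXne i) (hXcomp i) (hcont i) μ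
          exact hle _ (hx i)
      _ = ∑ s, μ s * ∑ i, g i s (x i s) := sum_sum_mul_eq μ fun i s => g i s (x i s)
      _ ≤ _ := sum_mul_le_iSup hμ _
  obtain ⟨a, ha, b, hb, hab⟩ := exists_isSaddlePointOn_lagrangian hS hXne hXconv hXcomp hg
  have hP : (⨆ s, ∑ i, g i s (a i s)) ∈ primalSet X g := ⟨a, fun i => ha i trivial, rfl⟩
  have hD : ∑ i, dualFn X g i b ∈ dualSet X g := ⟨b, hb, rfl⟩
  have strong : (⨆ s, ∑ i, g i s (a i s)) ≤ ∑ i, dualFn X g i b := by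
    choose ξ hξ hξ_eq _ using fun i => exists_dualFn_isLeast (hXne i) (hXcomp i) (hcont i) b
    simp only [hξ_eq]
    rw [sum_sum_mul_eq b fun i s => g i s (ξ i s)]
    refine ciSup_le fun s => ?_
    simpa [Pi.single_apply] using
      hab ξ (fun i _ => hξ i) (Pi.single s 1) (single_mem_stdSimplex ℝ s)
  have heq := le_antisymm strong (weak _ hD _ hP)
  have hleast : IsLeast (primalSet X g) (⨆ s, ∑ i, g i s (a i s)) :=
    ⟨hP, fun P hP' => heq.trans_le (weak _ hD P hP')⟩
  have hgreatest : IsGreatest (dualSet X g) (∑ i, dualFn X g i b) :=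
    ⟨hD, fun v hv => (weak v hv _ hP).trans_eq heq⟩
  exact ⟨hleast.bddBelow, hleast.nonempty, hgreatest.bddAbove, hgreatest.nonempty, by
    rw [hgreatest.csSup_eq, hleast.csInf_eq, heq]⟩

end
end

section
/- Strong duality for the edge-decomposed dual problem (Lemma 2): the optimal value η* := inf over all collections {λ^{ij}}_{(i,j)∈E} with λ^{ij} ∈ ℝ^S of η({λ^{ij}}) is finite and satisfies η* = sup_{μ ∈ Δ} Σ_{i=1}^N q^i(μ) = P*. -/
open Finset Filter Topology

noncomputable section

/-- The antisymmetrized sum of the edge multipliers at node `i`: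
`Σ_{j ∈ N_i} (λ^{ij} − λ^{ji})`. -/
def edgeDiff {N S : ℕ} (G : SimpleGraph (Fin N)) [DecidableRel G.Adj]
    (lam : Fin N → Fin N → Fin S → ℝ) (i : Fin N) : Fin S → ℝ :=
  ∑ j ∈ Finset.univ.filter (fun j => G.Adj i j), (lam i j - lam j i)

/-- The dual-of-dual objective `η({λ^{ij}}) = Σ_i η^i`, where
`η^i = sup_{μ ∈ Δ} ( q^i(μ) + μᵀ Σ_{j∈N_i}(λ^{ij} − λ^{ji}) )`. -/
def etaFn {N S : ℕ} (X : Fin N → Set (Fin S → ℝ))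
    (g : Fin N → Fin S → ℝ → ℝ) (G : SimpleGraph (Fin N)) [DecidableRel G.Adj]
    (lam : Fin N → Fin N → Fin S → ℝ) : ℝ :=
  ∑ i, sSup {v | ∃ μ ∈ unitSimplex S,
    v = dualFn X g i μ + ∑ s, μ s * edgeDiff G lam i s}

theorem edgeDiff_zero {N S : ℕ} (G : SimpleGraph (Fin N)) [DecidableRel G.Adj] :
    edgeDiff (S := S) G 0 = 0 := by
  funext i
  simp [edgeDiff]

theorem edgeDiff_add {N S : ℕ} (G : SimpleGraph (Fin N)) [DecidableRel G.Adj]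
    (l m : Fin N → Fin N → Fin S → ℝ) :
    edgeDiff G (l + m) = edgeDiff G l + edgeDiff G m := by
  funext i
  simp only [edgeDiff, Pi.add_apply, ← Finset.sum_add_distrib]
  exact Finset.sum_congr rfl fun j _ => by abel

theorem edgeDiff_single {N S : ℕ} (G : SimpleGraph (Fin N)) [DecidableRel G.Adj]
    {i j : Fin N} (h : G.Adj i j) (v : Fin S → ℝ) :
    edgeDiff G (Pi.single i (Pi.single j v)) = Pi.single i v - Pi.single j v := by
  have key : ∀ k l : Fin N, (Pi.single i (Pi.single j v) : Fin N → Fin N → Fin S → ℝ) k l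
      = if l = j then (if k = i then v else 0) else 0 := by
    intro k l
    by_cases hk : k = i
    · subst hk
      by_cases hl : l = j
      · subst hl
        simp
      · simp [hl]
    · simp [hk]
  have key' : ∀ k l : Fin N, (Pi.single i (Pi.single j v) : Fin N → Fin N → Fin S → ℝ) l k
      = if l = i then (if k = j then v else 0) else 0 := by
    intro k l
    rw [key]
    split_ifs <;> rfl
  funext k
  simp only [edgeDiff, Finset.sum_sub_distrib, Pi.sub_apply, key k, key' k]
  simp only [Finset.sum_ite_eq', Finset.mem_filter, Finset.mem_univ, true_and, Pi.single_apply]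
  congr 1
  · by_cases hk : k = i
    · subst hk
      simp [h]
    · simp [hk]
  · by_cases hk : k = j
    · subst hk
      simp [h.symm]
    · simp [hk]

/-- On a connected graph every node vector with zero total is an antisymmetrized edge sum. -/
theorem exists_edgeDiff_eq {N S : ℕ} (G : SimpleGraph (Fin N)) [DecidableRel G.Adj]
    (hconn : G.Connected) (d : Fin N → Fin S → ℝ) (hd : ∑ i, d i = 0) :
    ∃ lam, edgeDiff G lam = d := by
  have hpair : ∀ (i j : Fin N) (v : Fin S → ℝ),
      ∃ lam, edgeDiff G lam = Pi.single i v - Pi.single j v := by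
    intro i j v
    obtain ⟨w⟩ := hconn.preconnected i j
    induction w with
    | nil => exact ⟨0, by simp [edgeDiff_zero]⟩
    | cons h _ ih =>
      obtain ⟨l, hl⟩ := ih
      exact ⟨_ + l, by rw [edgeDiff_add, edgeDiff_single G h v, hl]; abel⟩
  obtain ⟨r⟩ := hconn.nonempty
  have hsum : ∀ t : Finset (Fin N),
      ∃ lam, edgeDiff G lam = ∑ i ∈ t, (Pi.single i (d i) - Pi.single r (d i)) := by
    intro t
    induction t using Finset.induction_on with
    | empty => exact ⟨0, by simp [edgeDiff_zero]⟩
    | insert a t ha ih =>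
      obtain ⟨l, hl⟩ := ih
      obtain ⟨m, hm⟩ := hpair a r (d a)
      exact ⟨m + l, by rw [edgeDiff_add, hl, hm, Finset.sum_insert ha]⟩
  obtain ⟨lam, hlam⟩ := hsum Finset.univ
  refine ⟨lam, hlam.trans ?_⟩
  have hr : ∑ i, (Pi.single r (d i) : Fin N → Fin S → ℝ) = Pi.single r (∑ i, d i) :=
    (map_sum (AddMonoidHom.single (fun _ : Fin N => Fin S → ℝ) r) d Finset.univ).symm
  rw [Finset.sum_sub_distrib, hr, hd, Pi.single_zero, sub_zero, Finset.univ_sum_single]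

theorem sum_edgeDiff {N S : ℕ} (G : SimpleGraph (Fin N)) [DecidableRel G.Adj]
    (lam : Fin N → Fin N → Fin S → ℝ) : ∑ i, edgeDiff G lam i = 0 := by
  simp only [edgeDiff, Finset.sum_filter]
  have h : ∀ i j, (if G.Adj i j then lam i j - lam j i else 0)
      = (if G.Adj i j then lam i j else 0) - (if G.Adj j i then lam j i else 0) := by
    intro i j
    simp only [G.adj_comm j i]
    split_ifs <;> simp
  simp only [h, Finset.sum_sub_distrib]
  rw [sub_eq_zero]
  exact Finset.sum_comm

theorem sum_mul_le_of_mem_unitSimplex {S : ℕ} {μ c : Fin S → ℝ} {C : ℝ}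
    (hμ : μ ∈ unitSimplex S) (h : ∀ s, c s ≤ C) : ∑ s, μ s * c s ≤ C :=
  calc ∑ s, μ s * c s ≤ ∑ s, μ s * C :=
        Finset.sum_le_sum fun s _ => mul_le_mul_of_nonneg_left (h s) (hμ.1 s)
    _ = C := by rw [← Finset.sum_mul, hμ.2, one_mul]

theorem single_mem_unitSimplex {S : ℕ} (s : Fin S) :
    (Pi.single s 1 : Fin S → ℝ) ∈ unitSimplex S :=
  single_mem_stdSimplex ℝ s

theorem continuous_weightedSum {S : ℕ} {g : Fin S → ℝ → ℝ}
    (hg : ∀ s, ConvexOn ℝ Set.univ (g s)) (μ : Fin S → ℝ) :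
    Continuous fun x : Fin S → ℝ => ∑ s, μ s * g s (x s) := by
  have hc : ∀ s, Continuous (g s) := fun s =>
    continuousOn_univ.1 ((hg s).continuousOn isOpen_univ)
  fun_prop

theorem dualFn_le {N S : ℕ} {X : Fin N → Set (Fin S → ℝ)}
    (hXcomp : ∀ i, IsCompact (X i)) {g : Fin N → Fin S → ℝ → ℝ}
    (hg : ∀ i s, ConvexOn ℝ Set.univ (g i s)) {i : Fin N} (μ : Fin S → ℝ)
    {x : Fin S → ℝ} (hx : x ∈ X i) :
    dualFn X g i μ ≤ ∑ s, μ s * g i s (x s) :=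
  csInf_le ((hXcomp i).image (continuous_weightedSum (hg i) μ)).bddBelow
    (Set.mem_image_of_mem _ hx)

theorem exists_dualFn_eq {N S : ℕ} {X : Fin N → Set (Fin S → ℝ)}
    (hXne : ∀ i, (X i).Nonempty) (hXcomp : ∀ i, IsCompact (X i))
    {g : Fin N → Fin S → ℝ → ℝ}
    (hg : ∀ i s, ConvexOn ℝ Set.univ (g i s)) (i : Fin N) (μ : Fin S → ℝ) :
    ∃ x ∈ X i, ∑ s, μ s * g i s (x s) = dualFn X g i μ :=
  ((hXcomp i).image (continuous_weightedSum (hg i) μ)).sInf_mem ((hXne i).image _)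

/-- Weak duality between the dual and the edge-decomposed dual of the dual. -/
theorem sum_dualFn_le_etaFn {N S : ℕ} {X : Fin N → Set (Fin S → ℝ)}
    (hXne : ∀ i, (X i).Nonempty) (hXcomp : ∀ i, IsCompact (X i))
    {g : Fin N → Fin S → ℝ → ℝ} (hg : ∀ i s, ConvexOn ℝ Set.univ (g i s))
    (G : SimpleGraph (Fin N)) [DecidableRel G.Adj]
    (lam : Fin N → Fin N → Fin S → ℝ) {μ : Fin S → ℝ} (hμ : μ ∈ unitSimplex S) :
    ∑ i, dualFn X g i μ ≤ etaFn X g G lam := by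
  have hzero : ∑ i, ∑ s, μ s * edgeDiff G lam i s = 0 := by
    rw [Finset.sum_comm]
    refine Finset.sum_eq_zero fun s _ => ?_
    rw [← Finset.mul_sum, ← Finset.sum_apply, sum_edgeDiff, Pi.zero_apply, mul_zero]
  calc ∑ i, dualFn X g i μ
      = ∑ i, (dualFn X g i μ + ∑ s, μ s * edgeDiff G lam i s) := by
        rw [Finset.sum_add_distrib, hzero, add_zero]
    _ ≤ etaFn X g G lam := by
        refine Finset.sum_le_sum fun i _ => le_csSup ?_ ⟨μ, hμ, rfl⟩
        obtain ⟨x, hx⟩ := hXne i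
        refine ⟨⨆ s, (g i s (x s) + edgeDiff G lam i s), ?_⟩
        rintro _ ⟨ν, hν, rfl⟩
        refine (add_le_add_left (dualFn_le hXcomp hg ν hx) _).trans ?_
        rw [← Finset.sum_add_distrib]
        simp only [← mul_add]
        exact sum_mul_le_of_mem_unitSimplex hν fun s =>
          le_ciSup (f := fun s => g i s (x s) + edgeDiff G lam i s)
            (Set.finite_range _).bddAbove s

/-- Every primal value is matched or beaten by suitable edge multipliers. -/
theorem exists_etaFn_le {N S : ℕ} (hN : 0 < N) (hS : 0 < S)
    {X : Fin N → Set (Fin S → ℝ)} (hXcomp : ∀ i, IsCompact (X i))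
    {g : Fin N → Fin S → ℝ → ℝ} (hg : ∀ i s, ConvexOn ℝ Set.univ (g i s))
    (G : SimpleGraph (Fin N)) [DecidableRel G.Adj] (hconn : G.Connected)
    {x : Fin N → Fin S → ℝ} (hx : ∀ i, x i ∈ X i) :
    ∃ lam, etaFn X g G lam ≤ ⨆ s : Fin S, ∑ i, g i s (x i s) := by
  have hN' : (N : ℝ) ≠ 0 := by exact_mod_cast hN.ne'
  obtain ⟨lam, hlam⟩ := exists_edgeDiff_eq G hconn
    (fun i s => (∑ j, g j s (x j s)) / N - g i s (x i s)) (by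
      funext s
      simp only [Finset.sum_apply, Finset.sum_sub_distrib, Finset.sum_const, Finset.card_univ,
        Fintype.card_fin, nsmul_eq_mul, Pi.zero_apply]
      field_simp
      ring)
  refine ⟨lam, ?_⟩
  set P := ⨆ s : Fin S, ∑ i, g i s (x i s)
  calc etaFn X g G lam ≤ ∑ _i : Fin N, P / N := by
        refine Finset.sum_le_sum fun i _ => csSup_le ?_ ?_
        · exact ⟨_, _, single_mem_unitSimplex ⟨0, hS⟩, rfl⟩
        · rintro _ ⟨μ, hμ, rfl⟩
          refine (add_le_add_left (dualFn_le hXcomp hg μ (hx i)) _).trans ?_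
          rw [← Finset.sum_add_distrib]
          simp only [← mul_add, hlam, add_sub_cancel]
          refine sum_mul_le_of_mem_unitSimplex hμ fun s => ?_
          gcongr
          exact le_ciSup (f := fun s => ∑ i, g i s (x i s)) (Set.finite_range _).bddAbove s
    _ = P := by
        simp only [Finset.sum_const, Finset.card_univ, Fintype.card_fin, nsmul_eq_mul]
        field_simp

/-- Attainment and strong duality for the min-max problem, via Sion's theorem. -/
theorem exists_primal_le_dual {N S : ℕ} (hS : 0 < S)
    {X : Fin N → Set (Fin S → ℝ)} (hXne : ∀ i, (X i).Nonempty)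
    (hXconv : ∀ i, Convex ℝ (X i)) (hXcomp : ∀ i, IsCompact (X i))
    {g : Fin N → Fin S → ℝ → ℝ} (hg : ∀ i s, ConvexOn ℝ Set.univ (g i s)) :
    ∃ x : Fin N → Fin S → ℝ, (∀ i, x i ∈ X i) ∧ ∃ μ ∈ unitSimplex S,
      ⨆ s : Fin S, ∑ i, g i s (x i s) ≤ ∑ i, dualFn X g i μ := by
  have : Nonempty (Fin S) := ⟨⟨0, hS⟩⟩
  have hc : ∀ i s, Continuous (g i s) := fun i s =>
    continuousOn_univ.1 ((hg i s).continuousOn isOpen_univ)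
  obtain ⟨a, ha, μ, hμ, hsaddle⟩ := Sion.exists_isSaddlePointOn
    (X := Set.univ.pi X) (Y := unitSimplex S)
    (f := fun (x : Fin N → Fin S → ℝ) (μ : Fin S → ℝ) => ∑ i, ∑ s, μ s * g i s (x i s))
    (Set.univ_pi_nonempty_iff.2 hXne) (convex_pi fun i _ => hXconv i)
    (isCompact_univ_pi hXcomp)
    (fun μ _ => (Continuous.continuousOn (by fun_prop)).lowerSemicontinuousOn)
    (fun μ hμ => by
      refine ConvexOn.quasiconvexOn ⟨convex_pi fun i _ => hXconv i, ?_⟩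
      intro x _ y _ p q hp hq hpq
      simp only [smul_eq_mul, Finset.mul_sum, ← Finset.sum_add_distrib]
      refine Finset.sum_le_sum fun i _ => Finset.sum_le_sum fun s _ => ?_
      have h := mul_le_mul_of_nonneg_left
        ((hg i s).2 (Set.mem_univ (x i s)) (Set.mem_univ (y i s)) hp hq hpq) (hμ.1 s)
      simp only [smul_eq_mul] at h
      simp only [Pi.add_apply, Pi.smul_apply, smul_eq_mul]
      linarith)
    (convex_stdSimplex ℝ (Fin S)) ⟨_, single_mem_unitSimplex ⟨0, hS⟩⟩
    (isCompact_stdSimplex ℝ (Fin S))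
    (fun x _ => (Continuous.continuousOn (by fun_prop)).upperSemicontinuousOn)
    (fun x _ => by
      refine ConcaveOn.quasiconcaveOn ⟨convex_stdSimplex ℝ (Fin S), ?_⟩
      intro μ _ ν _ p q _ _ _
      simp only [smul_eq_mul, Finset.mul_sum, ← Finset.sum_add_distrib]
      refine Finset.sum_le_sum fun i _ => Finset.sum_le_sum fun s _ => ?_
      simp only [Pi.add_apply, Pi.smul_apply, smul_eq_mul]
      exact le_of_eq (by ring))
  refine ⟨a, fun i => ha i (Set.mem_univ i), μ, hμ, ciSup_le fun s => ?_⟩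
  choose y hy hyq using fun i => exists_dualFn_eq hXne hXcomp hg i μ
  have h := hsaddle y (fun i _ => hy i) _ (single_mem_unitSimplex s)
  simpa [hyq, Pi.single_apply] using h

/-- Strong duality for the edge-decomposed dual problem (Lemma 2):
`η* = inf_{λ} η({λ^{ij}})` is finite and `η* = q* = P*`. -/
theorem strong_duality_dual_dual (N S : ℕ) (hN : 0 < N) (hS : 0 < S)
    (X : Fin N → Set (Fin S → ℝ))
    (hXne : ∀ i, (X i).Nonempty)
    (hXconv : ∀ i, Convex ℝ (X i))
    (hXcomp : ∀ i, IsCompact (X i))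
    (g : Fin N → Fin S → ℝ → ℝ)
    (hg : ∀ i s, ConvexOn ℝ Set.univ (g i s))
    (G : SimpleGraph (Fin N)) [DecidableRel G.Adj]
    (hconn : G.Connected) :
    BddBelow (Set.range (etaFn X g G)) ∧
    sInf (Set.range (etaFn X g G)) = sSup (dualSet X g) ∧
    sSup (dualSet X g) = sInf (primalSet X g) := by
  obtain ⟨x, hx, μ, hμ, hle⟩ := exists_primal_le_dual hS hXne hXconv hXcomp hg
  have hweak : ∀ lam, ∀ ν ∈ unitSimplex S, ∑ i, dualFn X g i ν ≤ etaFn X g G lam :=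
    fun lam ν hν => sum_dualFn_le_etaFn hXne hXcomp hg G lam hν
  obtain ⟨lam, hlam⟩ := exists_etaFn_le hN hS hXcomp hg G hconn hx
  have hdual : IsGreatest (dualSet X g) (∑ i, dualFn X g i μ) := by
    refine ⟨⟨μ, hμ, rfl⟩, ?_⟩
    rintro _ ⟨ν, hν, rfl⟩
    exact (hweak lam ν hν).trans (hlam.trans hle)
  have heta : IsLeast (Set.range (etaFn X g G)) (∑ i, dualFn X g i μ) := by
    refine ⟨⟨lam, le_antisymm (hlam.trans hle) (hweak lam μ hμ)⟩, ?_⟩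
    rintro _ ⟨l, rfl⟩
    exact hweak l μ hμ
  have hprimal : IsLeast (primalSet X g) (∑ i, dualFn X g i μ) := by
    refine ⟨⟨x, hx, le_antisymm ((hweak lam μ hμ).trans hlam) hle⟩, ?_⟩
    rintro _ ⟨y, hy, rfl⟩
    obtain ⟨l, hl⟩ := exists_etaFn_le hN hS hXcomp hg G hconn hy
    exact (hweak l μ hμ).trans hl
  exact ⟨⟨_, heta.2⟩, heta.csInf_eq.trans hdual.csSup_eq.symm,
    hdual.csSup_eq.trans hprimal.csInf_eq.symm⟩

end
end

section
/- Convergence of the distributed dual subgradient method (Lemma 4): suppose γ satisfies the diminishing condition, the set of minimizers of η is nonempty, and sequences λ^{ij}(t) ∈ ℝ^S for (i,j) ∈ E and μ^i(t) ∈ ℝ^S for i ∈ {1,…,N} satisfy for all t ∈ ℕ: (i) for each i, μ^i(t+1) maximizes μ ↦ q^i(μ) + μᵀ Σ_{j∈N_i}(λ^{ij}(t) − λ^{ji}(t)) over Δ; (ii) for each (i,j) ∈ E, λ^{ij}(t+1) = λ^{ij}(t) − γ(t)(μ^i(t+1) − μ^j(t+1)). Then η({λ^{ij}(t)}) converges as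 t → ∞ to η* := inf over all collections {λ^{ij}} of η({λ^{ij}}). -/
open Finset Filter Topology

noncomputable section

/-- A nonnegative sequence that is summable against a non-summable, square-summable weight `γ`
and whose increments are `O(γ)` tends to zero. -/
theorem tendsto_zero_of_summable_mul {γ a : ℕ → ℝ} {C : ℝ}
    (hγ : ∀ t, 0 ≤ γ t)
    (hγdiv : Tendsto (fun n => ∑ t ∈ Finset.range n, γ t) atTop atTop)
    (hγsq : Summable fun t => γ t ^ 2) (ha : ∀ t, 0 ≤ a t)
    (hsum : Summable fun t => γ t * a t)
    (hinc : ∀ t, |a (t + 1) - a t| ≤ C * γ t) :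
    Tendsto a atTop (𝓝 0) := by
  have hdist : Summable fun t => dist (a t ^ 2) (a (t + 1) ^ 2) := by
    refine Summable.of_nonneg_of_le (fun _ => dist_nonneg) (fun t => ?_)
      ((hsum.mul_left (2 * C)).add (hγsq.mul_left (C ^ 2)))
    have hC : 0 ≤ C * γ t := (abs_nonneg _).trans (hinc t)
    have hle := (abs_le.1 (hinc t)).2
    have hsplit : dist (a t ^ 2) (a (t + 1) ^ 2) = |a (t + 1) - a t| * (a (t + 1) + a t) := by
      rw [dist_comm, Real.dist_eq, sq_sub_sq, abs_mul,
        abs_of_nonneg (add_nonneg (ha _) (ha _)), mul_comm]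
    rw [hsplit]
    calc |a (t + 1) - a t| * (a (t + 1) + a t)
        ≤ C * γ t * (2 * a t + C * γ t) :=
          mul_le_mul (hinc t) (by linarith) (add_nonneg (ha _) (ha _)) hC
      _ = 2 * C * (γ t * a t) + C ^ 2 * γ t ^ 2 := by ring
  obtain ⟨L, hL⟩ := cauchySeq_tendsto_of_complete (cauchySeq_of_summable_dist hdist)
  have hlim : Tendsto a atTop (𝓝 √L) := by
    simpa [Real.sqrt_sq (ha _)] using hL.sqrt
  rcases (Real.sqrt_nonneg L).eq_or_lt with h0 | hpos
  · rwa [← h0] at hlim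
  · exfalso
    have hev : ∀ᶠ t in atTop, √L / 2 < a t := hlim.eventually_const_lt (half_lt_self hpos)
    have hγsum : Summable γ := by
      refine Summable.of_norm_bounded_eventually_nat (hsum.mul_left (2 / √L)) ?_
      filter_upwards [hev] with t ht
      rw [Real.norm_of_nonneg (hγ t)]
      calc γ t = 2 / √L * (γ t * (√L / 2)) := by field_simp
        _ ≤ 2 / √L * (γ t * a t) := by
          have := hγ t
          gcongr
    exact not_tendsto_nhds_of_tendsto_atTop hγdiv _ hγsum.hasSum.tendsto_sum_nat

theorem le_one_of_mem_unitSimplex {S : ℕ} {μ : Fin S → ℝ} (hμ : μ ∈ unitSimplex S) (s : Fin S) :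
    μ s ≤ 1 :=
  hμ.2 ▸ Finset.single_le_sum (fun r _ => hμ.1 r) (Finset.mem_univ s)

theorem abs_sub_le_one_of_mem_unitSimplex {S : ℕ} {μ ν : Fin S → ℝ} (hμ : μ ∈ unitSimplex S)
    (hν : ν ∈ unitSimplex S) (s : Fin S) : |μ s - ν s| ≤ 1 := by
  have := hμ.1 s
  have := hν.1 s
  have := le_one_of_mem_unitSimplex hμ s
  have := le_one_of_mem_unitSimplex hν s
  rw [abs_le]
  constructor <;> linarith

section

variable {N S : ℕ} (X : Fin N → Set (Fin S → ℝ)) (g : Fin N → Fin S → ℝ → ℝ)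
  (G : SimpleGraph (Fin N)) [DecidableRel G.Adj]

/-- The sum of `f i j s` over all ordered adjacent pairs `(i, j)` and all coordinates `s`. -/
def edgeSum (f : Fin N → Fin N → Fin S → ℝ) : ℝ :=
  ∑ i, ∑ j with G.Adj i j, ∑ s, f i j s

variable {G} in
theorem edgeSum_le_edgeSum {f h : Fin N → Fin N → Fin S → ℝ}
    (hfh : ∀ i j s, G.Adj i j → f i j s ≤ h i j s) : edgeSum G f ≤ edgeSum G h :=
  Finset.sum_le_sum fun i _ => Finset.sum_le_sum fun j hj => Finset.sum_le_sum fun s _ =>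
    hfh i j s (Finset.mem_filter.1 hj).2

theorem edgeSum_add (f h : Fin N → Fin N → Fin S → ℝ) :
    edgeSum G (fun i j s => f i j s + h i j s) = edgeSum G f + edgeSum G h := by
  simp only [edgeSum, Finset.sum_add_distrib]

theorem edgeSum_const_mul (c : ℝ) (f : Fin N → Fin N → Fin S → ℝ) :
    edgeSum G (fun i j s => c * f i j s) = c * edgeSum G f := by
  simp only [edgeSum, Finset.mul_sum]

theorem edgeSum_swap (f : Fin N → Fin N → Fin S → ℝ) :
    edgeSum G (fun i j s => f j i s) = edgeSum G f := by
  simp only [edgeSum, Finset.sum_filter]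
  rw [Finset.sum_comm]
  simp only [G.adj_comm]

theorem sum_mul_edgeDiff (m : Fin N → Fin S → ℝ) (lam : Fin N → Fin N → Fin S → ℝ) :
    ∑ i, ∑ s, m i s * edgeDiff G lam i s
      = edgeSum G fun i j s => (m i s - m j s) * lam i j s := by
  have hleft : ∑ i, ∑ s, m i s * edgeDiff G lam i s
      = edgeSum G fun i j s => m i s * lam i j s + -1 * (m i s * lam j i s) := by
    refine Finset.sum_congr rfl fun i _ => ?_
    rw [Finset.sum_comm]
    refine Finset.sum_congr rfl fun s _ => ?_
    simp only [edgeDiff, Finset.sum_apply, Finset.mul_sum, Pi.sub_apply]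
    exact Finset.sum_congr rfl fun j _ => by ring
  rw [hleft, edgeSum_add, edgeSum_const_mul, ← edgeSum_swap G fun i j s => m i s * lam j i s,
    ← edgeSum_const_mul, ← edgeSum_add]
  congr 1
  ext i j s
  ring

/-- `m i` maximizes the local Lagrangian of agent `i` over the unit simplex, for every `i`. -/
def IsLocalMaximizer (lam : Fin N → Fin N → Fin S → ℝ) (m : Fin N → Fin S → ℝ) : Prop :=
  ∀ i, m i ∈ unitSimplex S ∧ ∀ ν ∈ unitSimplex S,
    dualFn X g i ν + ∑ s, ν s * edgeDiff G lam i s ≤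
      dualFn X g i (m i) + ∑ s, m i s * edgeDiff G lam i s

variable {X g G}

theorem IsLocalMaximizer.etaFn_eq {lam : Fin N → Fin N → Fin S → ℝ} {m : Fin N → Fin S → ℝ}
    (h : IsLocalMaximizer X g G lam m) :
    etaFn X g G lam = ∑ i, (dualFn X g i (m i) + ∑ s, m i s * edgeDiff G lam i s) := by
  refine Finset.sum_congr rfl fun i _ => IsGreatest.csSup_eq ⟨⟨m i, (h i).1, rfl⟩, ?_⟩
  rintro _ ⟨ν, hν, rfl⟩
  exact (h i).2 ν hν

theorem IsLocalMaximizer.bddAbove {lam : Fin N → Fin N → Fin S → ℝ} {m : Fin N → Fin S → ℝ}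
    (h : IsLocalMaximizer X g G lam m) (lam' : Fin N → Fin N → Fin S → ℝ) (i : Fin N) :
    BddAbove {v | ∃ μ ∈ unitSimplex S,
      v = dualFn X g i μ + ∑ s, μ s * edgeDiff G lam' i s} := by
  refine ⟨dualFn X g i (m i) + ∑ s, m i s * edgeDiff G lam i s
    + ∑ s, |edgeDiff G lam' i s - edgeDiff G lam i s|, ?_⟩
  rintro _ ⟨ν, hν, rfl⟩
  have hdiff : ∑ s, ν s * edgeDiff G lam' i s ≤ ∑ s, ν s * edgeDiff G lam i s
      + ∑ s, |edgeDiff G lam' i s - edgeDiff G lam i s| := by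
    rw [← Finset.sum_add_distrib]
    refine Finset.sum_le_sum fun s _ => ?_
    have hle := mul_le_mul_of_nonneg_left
      (le_abs_self (edgeDiff G lam' i s - edgeDiff G lam i s)) (hν.1 s)
    have hone := mul_le_of_le_one_left
      (abs_nonneg (edgeDiff G lam' i s - edgeDiff G lam i s)) (le_one_of_mem_unitSimplex hν s)
    linarith
  linarith [(h i).2 ν hν]

/-- The subgradient inequality: `(μ^i - μ^j)_{(i,j)}` is a subgradient of `η` at `lam`. -/
theorem IsLocalMaximizer.etaFn_sub_le {lam : Fin N → Fin N → Fin S → ℝ}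
    {m : Fin N → Fin S → ℝ} (h : IsLocalMaximizer X g G lam m)
    (lam' : Fin N → Fin N → Fin S → ℝ) :
    etaFn X g G lam - etaFn X g G lam'
      ≤ edgeSum G fun i j s => (m i s - m j s) * (lam i j s - lam' i j s) := by
  have hge : ∑ i, (dualFn X g i (m i) + ∑ s, m i s * edgeDiff G lam' i s)
      ≤ etaFn X g G lam' :=
    Finset.sum_le_sum fun i _ => le_csSup (h.bddAbove lam' i) ⟨m i, (h i).1, rfl⟩
  have hsplit : (edgeSum G fun i j s => (m i s - m j s) * (lam i j s - lam' i j s))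
      = (edgeSum G fun i j s => (m i s - m j s) * lam i j s)
        - edgeSum G fun i j s => (m i s - m j s) * lam' i j s := by
    simp only [edgeSum, mul_sub, Finset.sum_sub_distrib]
  rw [hsplit, ← sum_mul_edgeDiff, ← sum_mul_edgeDiff, h.etaFn_eq]
  rw [Finset.sum_add_distrib] at hge ⊢
  linarith

end

/-- Convergence of the distributed dual subgradient method (Lemma 4):
under a diminishing step-size and nonemptiness of the set of minimizers of `η`,
the iterates `{λ^{ij}(t)}` converge in objective value to `η* = inf η`. -/
theorem dual_subgradient_convergence (N S : ℕ) (hN : 0 < N) (hS : 0 < S)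
    (X : Fin N → Set (Fin S → ℝ))
    (hXne : ∀ i, (X i).Nonempty)
    (hXconv : ∀ i, Convex ℝ (X i))
    (hXcomp : ∀ i, IsCompact (X i))
    (g : Fin N → Fin S → ℝ → ℝ)
    (hg : ∀ i s, ConvexOn ℝ Set.univ (g i s))
    (G : SimpleGraph (Fin N)) [DecidableRel G.Adj]
    (hconn : G.Connected)
    (γ : ℕ → ℝ)
    (hγnonneg : ∀ t, 0 ≤ γ t)
    (hγto0 : Tendsto γ atTop (𝓝 0))
    (hγdiv : Tendsto (fun n => ∑ t ∈ Finset.range n, γ t) atTop atTop)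
    (hγsq : Summable (fun t => γ t ^ 2))
    (hmin : ∃ lamstar : Fin N → Fin N → Fin S → ℝ,
      ∀ lam, etaFn X g G lamstar ≤ etaFn X g G lam)
    (lam : ℕ → Fin N → Fin N → Fin S → ℝ)
    (μ : ℕ → Fin N → Fin S → ℝ)
    (hmax : ∀ t i, μ (t + 1) i ∈ unitSimplex S ∧
      ∀ ν ∈ unitSimplex S,
        dualFn X g i ν + ∑ s, ν s * edgeDiff G (lam t) i s ≤
        dualFn X g i (μ (t + 1) i) + ∑ s, μ (t + 1) i s * edgeDiff G (lam t) i s)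
    (hupd : ∀ t i j, G.Adj i j →
      lam (t + 1) i j = lam t i j - γ t • (μ (t + 1) i - μ (t + 1) j)) :
    Tendsto (fun t => etaFn X g G (lam t)) atTop
      (𝓝 (sInf (Set.range (etaFn X g G)))) := by
  obtain ⟨lamstar, hstar⟩ := hmin
  have hinf : sInf (Set.range (etaFn X g G)) = etaFn X g G lamstar :=
    IsLeast.csInf_eq ⟨⟨lamstar, rfl⟩, by rintro _ ⟨l, rfl⟩; exact hstar l⟩
  have hm (t : ℕ) : IsLocalMaximizer X g G (lam t) (μ (t + 1)) := hmax t
  have hμ (t : ℕ) (i : Fin N) : μ (t + 1) i ∈ unitSimplex S := (hmax t i).1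
  have hstep (t : ℕ) (i j : Fin N) (s : Fin S) (hij : G.Adj i j) :
      lam (t + 1) i j s = lam t i j s - γ t * (μ (t + 1) i s - μ (t + 1) j s) := by
    simp [hupd t i j hij]
  set C : ℝ := edgeSum G fun (_ _ : Fin N) (_ : Fin S) => (1 : ℝ) with hC
  set a : ℕ → ℝ := fun t => etaFn X g G (lam t) - etaFn X g G lamstar with ha_def
  have ha (t : ℕ) : 0 ≤ a t := sub_nonneg.2 (hstar _)
  have hbound (t u : ℕ) (i j : Fin N) (s : Fin S) :
      |(μ (t + 1) i s - μ (t + 1) j s) * (μ (u + 1) i s - μ (u + 1) j s)| ≤ 1 := by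
    rw [abs_mul]
    exact mul_le_one₀ (abs_sub_le_one_of_mem_unitSimplex (hμ t i) (hμ t j) s) (abs_nonneg _)
      (abs_sub_le_one_of_mem_unitSimplex (hμ u i) (hμ u j) s)
  have hinc (t : ℕ) : |a (t + 1) - a t| ≤ C * γ t := by
    have hup := (hm (t + 1)).etaFn_sub_le (lam t)
    have hdown := (hm t).etaFn_sub_le (lam (t + 1))
    have hup' : _ ≤ edgeSum G fun (_ _ : Fin N) (_ : Fin S) => γ t * 1 :=
      hup.trans <| edgeSum_le_edgeSum fun i j s hij => by
        rw [hstep t i j s hij]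
        have := mul_le_mul_of_nonneg_left (abs_le.1 (hbound (t + 1) t i j s)).1 (hγnonneg t)
        linarith
    have hdown' : _ ≤ edgeSum G fun (_ _ : Fin N) (_ : Fin S) => γ t * 1 :=
      hdown.trans <| edgeSum_le_edgeSum fun i j s hij => by
        rw [hstep t i j s hij]
        have := mul_le_mul_of_nonneg_left (abs_le.1 (hbound t t i j s)).2 (hγnonneg t)
        linarith
    rw [edgeSum_const_mul, ← hC] at hup' hdown'
    rw [abs_le]
    constructor <;> simp only [ha_def] <;> linarith
  set V : ℕ → ℝ := fun t => edgeSum G fun i j s => (lam t i j s - lamstar i j s) ^ 2 with hV_def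
  have hV (t : ℕ) : 0 ≤ V t :=
    Finset.sum_nonneg fun i _ => Finset.sum_nonneg fun j _ => Finset.sum_nonneg fun s _ =>
      sq_nonneg _
  have hdescent (t : ℕ) : V (t + 1) + 2 * (γ t * a t) ≤ V t + C * γ t ^ 2 := by
    have hsub := mul_le_mul_of_nonneg_left ((hm t).etaFn_sub_le lamstar) (hγnonneg t)
    have hexp : V (t + 1) + 2 * γ t * (edgeSum G fun i j s =>
        (μ (t + 1) i s - μ (t + 1) j s) * (lam t i j s - lamstar i j s))
        ≤ V t + γ t ^ 2 * C := by
      simp only [hV_def, hC]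
      rw [← edgeSum_const_mul, ← edgeSum_const_mul, ← edgeSum_add, ← edgeSum_add]
      refine edgeSum_le_edgeSum fun i j s hij => ?_
      rw [hstep t i j s hij]
      have := mul_le_mul_of_nonneg_left (abs_le.1 (hbound t t i j s)).2 (sq_nonneg (γ t))
      linarith
    simp only [ha_def]
    linarith
  have hpartial (n : ℕ) : V n + 2 * ∑ t ∈ Finset.range n, γ t * a t
      ≤ V 0 + C * ∑ t ∈ Finset.range n, γ t ^ 2 := by
    induction n with
    | zero => simp
    | succ n ih =>
      rw [Finset.sum_range_succ, Finset.sum_range_succ]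
      linarith [hdescent n]
  have hC0 : 0 ≤ C :=
    Finset.sum_nonneg fun i _ => Finset.sum_nonneg fun j _ => Finset.sum_nonneg fun s _ =>
      zero_le_one
  have hsum : Summable fun t => γ t * a t := by
    refine summable_of_sum_range_le (c := (V 0 + C * ∑' t, γ t ^ 2) / 2)
      (fun t => mul_nonneg (hγnonneg t) (ha t)) fun n => ?_
    have := mul_le_mul_of_nonneg_left
      (hγsq.sum_le_tsum (Finset.range n) fun t _ => sq_nonneg (γ t)) hC0
    linarith [hpartial n, hV n]
  rw [hinf]
  simpa [ha_def] using
    (tendsto_zero_of_summable_mul hγnonneg hγdiv hγsq ha hsum hinc).add_const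
      (etaFn X g G lamstar)

end
end

section
/- Existence of a saddle point for the local problem (Lemma 6, second part): for every c ∈ ℝ^S, defining φ(x, μ) := Σ_{s=1}^S μ_s ( g_s(x_s) + c_s ), there exist x* ∈ X and μ* ∈ Δ such that φ(x*, μ) ≤ φ(x*, μ*) ≤ φ(x, μ*) for all x ∈ X and all μ ∈ Δ. -/
open Finset Filter Topology

noncomputable section

/-- A nonnegative combination of convex functions of the separate coordinates is convex. -/
theorem convexOn_sum_mul_coord {S : ℕ} {X : Set (Fin S → ℝ)} (hX : Convex ℝ X)
    {g : Fin S → ℝ → ℝ} (hg : ∀ s, ConvexOn ℝ Set.univ (g s)) (c : Fin S → ℝ)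
    {μ : Fin S → ℝ} (hμ : ∀ s, 0 ≤ μ s) :
    ConvexOn ℝ X fun x => ∑ s, μ s * (g s (x s) + c s) := by
  refine ⟨hX, fun x _ y _ a b ha hb hab => ?_⟩
  simp only [smul_eq_mul, Finset.mul_sum, ← Finset.sum_add_distrib]
  refine Finset.sum_le_sum fun s _ => ?_
  have h := (hg s).2 (Set.mem_univ (x s)) (Set.mem_univ (y s)) ha hb hab
  simp only [smul_eq_mul] at h
  calc μ s * (g s ((a • x + b • y) s) + c s)
      ≤ μ s * ((a * g s (x s) + b * g s (y s)) + (a + b) * c s) := by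
        rw [hab, one_mul]
        exact mul_le_mul_of_nonneg_left (by simpa using h) (hμ s)
    _ = a * (μ s * (g s (x s) + c s)) + b * (μ s * (g s (y s) + c s)) := by ring

/-- A linear form is concave on any convex set. -/
theorem concaveOn_sum_mul_const {S : ℕ} {Y : Set (Fin S → ℝ)} (hY : Convex ℝ Y)
    (v : Fin S → ℝ) : ConcaveOn ℝ Y fun μ => ∑ s, μ s * v s := by
  refine ⟨hY, fun x _ y _ a b _ _ _ => le_of_eq ?_⟩
  simp only [smul_eq_mul, Finset.mul_sum, ← Finset.sum_add_distrib, Pi.add_apply, Pi.smul_apply]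
  exact Finset.sum_congr rfl fun s _ => by ring

/-- Existence of a saddle point for the local problem (Lemma 6, second part):
for `φ(x,μ) = Σ_s μ_s (g_s(x_s)+c_s)` there exist `x* ∈ X` and `μ* ∈ Δ` with
`φ(x*,μ) ≤ φ(x*,μ*) ≤ φ(x,μ*)` for all `x ∈ X`, `μ ∈ Δ`. -/
theorem local_saddle_point_exists (S : ℕ) (hS : 0 < S)
    (X : Set (Fin S → ℝ))
    (hXne : X.Nonempty)
    (hXconv : Convex ℝ X)
    (hXcomp : IsCompact X)
    (g : Fin S → ℝ → ℝ)
    (hg : ∀ s, ConvexOn ℝ Set.univ (g s))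
    (c : Fin S → ℝ) :
    ∃ xstar ∈ X, ∃ μstar ∈ unitSimplex S,
      (∀ μ ∈ unitSimplex S,
        ∑ s, μ s * (g s (xstar s) + c s) ≤ ∑ s, μstar s * (g s (xstar s) + c s)) ∧
      (∀ x ∈ X,
        ∑ s, μstar s * (g s (xstar s) + c s) ≤ ∑ s, μstar s * (g s (x s) + c s)) := by
  have hgc : ∀ s, Continuous (g s) := fun s =>
    continuousOn_univ.mp ((hg s).continuousOn isOpen_univ)
  have hne : (unitSimplex S).Nonempty :=
    ⟨Pi.single ⟨0, hS⟩ 1, single_mem_stdSimplex ℝ (⟨0, hS⟩ : Fin S)⟩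
  have hconv : Convex ℝ (unitSimplex S) := convex_stdSimplex ℝ (Fin S)
  have hcomp : IsCompact (unitSimplex S) := isCompact_stdSimplex ℝ (Fin S)
  obtain ⟨x, hx, μ, hμ, h⟩ := Sion.exists_isSaddlePointOn
    (f := fun x μ : Fin S → ℝ => ∑ s, μ s * (g s (x s) + c s)) hXne hXconv hXcomp
    (fun μ _ => Continuous.lowerSemicontinuous (by fun_prop) |>.lowerSemicontinuousOn _)
    (fun μ hμ => (convexOn_sum_mul_coord hXconv hg c hμ.1).quasiconvexOn)
    hconv hne hcomp
    (fun x _ => Continuous.upperSemicontinuous (by fun_prop) |>.upperSemicontinuousOn _)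
    (fun x _ => (concaveOn_sum_mul_const hconv _).quasiconcaveOn)
  exact ⟨x, hx, μ, hμ, fun ν hν => h x hx ν hν, fun y hy => h y hy μ hμ⟩

end
end

section
/- Local primal value equals local dual value (Corollary 1): for every c ∈ ℝ^S, the optimal value of the local epigraph problem, inf_{x ∈ X} max_{s ∈ {1,…,S}} ( g_s(x_s) + c_s ), equals sup_{μ ∈ Δ} ( q(μ) + μᵀ c ), where q(μ) := inf_{x ∈ X} Σ_{s=1}^S μ_s g_s(x_s). -/
open Finset Filter Topology

noncomputable section

/-- The local dual function `q(μ) = inf_{x ∈ X} Σ_s μ_s g_s(x_s)`. -/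
def dualFn0 {S : ℕ} (X : Set (Fin S → ℝ)) (g : Fin S → ℝ → ℝ) (μ : Fin S → ℝ) : ℝ :=
  sInf ((fun x : Fin S → ℝ => ∑ s, μ s * g s (x s)) '' X)

/-- Theorem of the alternative: if the maximum of finitely many convex functions is at least `p`
on a convex set, then so is one of their convex combinations. -/
theorem ConvexOn.exists_weights_le_sum {ι E : Type*} [Fintype ι] [AddCommGroup E] [Module ℝ E]
    {X : Set E} (hne : X.Nonempty) (hX : Convex ℝ X) {f : ι → E → ℝ}
    (hf : ∀ i, ConvexOn ℝ X (f i)) {p : ℝ} (hp : ∀ x ∈ X, ∃ i, p ≤ f i x) :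
    ∃ μ : ι → ℝ, (∀ i, 0 ≤ μ i) ∧ ∑ i, μ i = 1 ∧ ∀ x ∈ X, p ≤ ∑ i, μ i * f i x := by
  classical
  let A : Set (ι → ℝ) := Set.pi Set.univ fun _ => Set.Iio p
  let B : Set (ι → ℝ) := {y | ∃ x ∈ X, ∀ i, f i x ≤ y i}
  have hA : Convex ℝ A := convex_pi fun _ _ => convex_Iio p
  have hAo : IsOpen A := isOpen_set_pi Set.finite_univ fun _ _ => isOpen_Iio
  have hB : Convex ℝ B := by
    rintro y ⟨x, hx, hxy⟩ z ⟨w, hw, hwz⟩ a b ha hb hab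
    refine ⟨a • x + b • w, hX hx hw ha hb hab, fun i => ?_⟩
    refine ((hf i).2 hx hw ha hb hab).trans ?_
    simp only [smul_eq_mul, Pi.add_apply, Pi.smul_apply]
    gcongr
    · exact hxy i
    · exact hwz i
  have hAB : Disjoint A B := by
    rw [Set.disjoint_left]
    rintro y hy ⟨x, hx, hxy⟩
    obtain ⟨i, hi⟩ := hp x hx
    exact absurd (hi.trans (hxy i)) (not_le.2 (hy i trivial))
  obtain ⟨φ, u, hφA, hφB⟩ := geometric_hahn_banach_open hA hAo hB hAB
  have hφ (y : ι → ℝ) : φ y = ∑ i, φ (Pi.single i 1) * y i := by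
    conv_lhs => rw [pi_eq_sum_univ' y]
    simp [map_sum, mul_comm]
  set a : ι → ℝ := fun i => φ (Pi.single i 1)
  obtain ⟨x₀, hx₀⟩ := hne
  have hnonneg (i : ι) : 0 ≤ a i := by
    by_contra! hneg
    obtain ⟨n, hn⟩ := exists_nat_gt ((φ (fun j => f j x₀) - u) / -a i)
    rw [div_lt_iff₀ (by linarith)] at hn
    have hmem : (fun j => f j x₀) + (n : ℝ) • Pi.single i (1 : ℝ) ∈ B := by
      refine ⟨x₀, hx₀, fun j => ?_⟩
      have : (0 : ℝ) ≤ (Pi.single i 1 : ι → ℝ) j := by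
        by_cases h : j = i
        · subst h; simp
        · simp [h]
      simp only [Pi.add_apply, Pi.smul_apply, smul_eq_mul]
      have := mul_nonneg (Nat.cast_nonneg (α := ℝ) n) this
      linarith
    have := hφB _ hmem
    rw [map_add, map_smul, smul_eq_mul] at this
    change u ≤ _ + n * a i at this
    linarith
  have hsum_nonneg : 0 ≤ ∑ i, a i := sum_nonneg fun i _ => hnonneg i
  have hconst (t : ℝ) (ht : t < p) : (∑ i, a i) * t < u := by
    have := hφA (fun _ => t) fun _ _ => ht
    rwa [hφ, ← sum_mul] at this
  have hle (x : E) (hx : x ∈ X) : u ≤ ∑ i, a i * f i x := by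
    have := hφB (fun i => f i x) ⟨x, hx, fun _ => le_rfl⟩
    rwa [hφ] at this
  have hpos : 0 < ∑ i, a i := by
    refine hsum_nonneg.lt_of_ne fun h => ?_
    have hz := (sum_eq_zero_iff_of_nonneg fun i _ => hnonneg i).1 h.symm
    have h₁ := hconst (p - 1) (by linarith)
    have h₂ := hle x₀ hx₀
    rw [← h, zero_mul] at h₁
    rw [sum_eq_zero fun i hi => by rw [hz i hi, zero_mul]] at h₂
    linarith
  refine ⟨fun i => a i / ∑ j, a j, fun i => div_nonneg (hnonneg i) hsum_nonneg, ?_,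
    fun x hx => ?_⟩
  · rw [← sum_div, div_self hpos.ne']
  · have hpu : p ≤ u / ∑ j, a j := by
      refine le_of_forall_lt fun t ht => ?_
      rw [lt_div_iff₀ hpos, mul_comm]
      exact hconst t ht
    refine hpu.trans ?_
    simp_rw [div_mul_eq_mul_div]
    rw [← sum_div]
    exact div_le_div_of_nonneg_right (hle x hx) hsum_nonneg

/-- Local primal value equals local dual value (Corollary 1):
`inf_{x ∈ X} max_s (g_s(x_s)+c_s) = sup_{μ ∈ Δ} ( q(μ) + μᵀc )`. -/
theorem local_primal_eq_dual (S : ℕ) (hS : 0 < S)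
    (X : Set (Fin S → ℝ))
    (hXne : X.Nonempty)
    (hXconv : Convex ℝ X)
    (hXcomp : IsCompact X)
    (g : Fin S → ℝ → ℝ)
    (hg : ∀ s, ConvexOn ℝ Set.univ (g s))
    (c : Fin S → ℝ) :
    sInf ((fun x : Fin S → ℝ => ⨆ s : Fin S, (g s (x s) + c s)) '' X) =
    sSup {v | ∃ μ ∈ unitSimplex S, v = dualFn0 X g μ + ∑ s, μ s * c s} := by
  have : Nonempty (Fin S) := ⟨⟨0, hS⟩⟩
  have hcont (s : Fin S) : Continuous (g s) :=
    continuousOn_univ.1 ((hg s).continuousOn isOpen_univ)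
  have hbddL (μ : Fin S → ℝ) :
      BddBelow ((fun x : Fin S → ℝ => ∑ s, μ s * g s (x s)) '' X) :=
    hXcomp.bddBelow_image (Continuous.continuousOn (by fun_prop))
  have hle_sup (x : Fin S → ℝ) (s : Fin S) : g s (x s) + c s ≤ ⨆ s, (g s (x s) + c s) :=
    le_ciSup (f := fun s => g s (x s) + c s) (Set.finite_range _).bddAbove s
  have hbddP : BddBelow ((fun x : Fin S → ℝ => ⨆ s : Fin S, (g s (x s) + c s)) '' X) := by
    obtain ⟨b, hb⟩ := hXcomp.bddBelow_image (f := fun x => g ⟨0, hS⟩ (x ⟨0, hS⟩) + c ⟨0, hS⟩)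
      (Continuous.continuousOn (by fun_prop))
    refine ⟨b, ?_⟩
    rintro _ ⟨x, hx, rfl⟩
    exact (hb ⟨x, hx, rfl⟩).trans (hle_sup x _)
  symm
  refine IsGreatest.csSup_eq ?_
  have hweak : sInf ((fun x : Fin S → ℝ => ⨆ s : Fin S, (g s (x s) + c s)) '' X) ∈
      upperBounds {v | ∃ μ ∈ unitSimplex S, v = dualFn0 X g μ + ∑ s, μ s * c s} := by
    rintro _ ⟨μ, ⟨hμ, hμ₁⟩, rfl⟩
    refine le_csInf (hXne.image _) ?_
    rintro _ ⟨x, hx, rfl⟩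
    calc dualFn0 X g μ + ∑ s, μ s * c s
        ≤ ∑ s, μ s * g s (x s) + ∑ s, μ s * c s :=
          add_le_add_left (csInf_le (hbddL μ) ⟨x, hx, rfl⟩) _
      _ = ∑ s, μ s * (g s (x s) + c s) := by simp only [mul_add, sum_add_distrib]
      _ ≤ ∑ s, μ s * ⨆ s, (g s (x s) + c s) :=
          sum_le_sum fun s _ => mul_le_mul_of_nonneg_left (hle_sup x s) (hμ s)
      _ = ⨆ s, (g s (x s) + c s) := by rw [← sum_mul, hμ₁, one_mul]
  refine ⟨?_, hweak⟩
  have hconv (s : Fin S) : ConvexOn ℝ X fun x => g s (x s) + c s := by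
    refine ConvexOn.add_const ?_ (c s)
    exact ((hg s).comp_linearMap (LinearMap.proj (R := ℝ) (φ := fun _ => ℝ) s)).subset
      (Set.subset_univ _) hXconv
  obtain ⟨μ, hμ, hμ₁, hle⟩ := ConvexOn.exists_weights_le_sum hXne hXconv hconv
    (p := sInf ((fun x : Fin S → ℝ => ⨆ s : Fin S, (g s (x s) + c s)) '' X)) fun x hx => by
      obtain ⟨s, hs⟩ := exists_eq_ciSup_of_finite (f := fun s => g s (x s) + c s)
      exact ⟨s, (csInf_le hbddP ⟨x, hx, rfl⟩).trans hs.ge⟩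
  refine ⟨μ, ⟨hμ, hμ₁⟩, le_antisymm ?_ (hweak ⟨μ, ⟨hμ, hμ₁⟩, rfl⟩)⟩
  rw [← sub_le_iff_le_add]
  refine le_csInf (hXne.image _) ?_
  rintro _ ⟨x, hx, rfl⟩
  have := hle x hx
  simp only [mul_add, sum_add_distrib] at this
  exact sub_le_iff_le_add.2 this

end
end

section
/- Sandwich inequality (equation (15)): suppose for each i ∈ {1,…,N}, x^i ∈ X^i and ρ^i ∈ ℝ satisfy g^i_s(x^i_s) + ( Σ_{j∈N_i} (λ^{ij} − λ^{ji}) )_s ≤ ρ^i for all s ∈ {1,…,S}, for some vectors λ^{ij} ∈ ℝ^S assigned to the ordered pairs (i,j) ∈ E. Then P* ≤ max_{s ∈ {1,…,S}} Σ_{i=1}^N g^i_s(x^i_s) ≤ Σ_{i=1}^N ρ^i. -/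
open Finset Filter Topology

noncomputable section

/-- Convex functions of a coordinate are bounded below on compact sets. -/
theorem ConvexOn.exists_forall_le_apply_of_isCompact {ι : Type*} {f : ℝ → ℝ}
    (hf : ConvexOn ℝ Set.univ f) {K : Set (ι → ℝ)} (hK : IsCompact K) (s : ι) :
    ∃ m, ∀ y ∈ K, m ≤ f (y s) := by
  have hcont : Continuous f := continuousOn_univ.mp (hf.continuousOn isOpen_univ)
  obtain ⟨m, hm⟩ := hK.bddBelow_image (hcont.comp (continuous_apply s)).continuousOn
  exact ⟨m, fun y hy => hm ⟨y, hy, rfl⟩⟩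

theorem bddBelow_primalSet {N S : ℕ} (hS : 0 < S) {X : Fin N → Set (Fin S → ℝ)}
    (hX : ∀ i, IsCompact (X i)) {g : Fin N → Fin S → ℝ → ℝ}
    (hg : ∀ i s, ConvexOn ℝ Set.univ (g i s)) : BddBelow (primalSet X g) := by
  choose m hm using fun i =>
    (hg i ⟨0, hS⟩).exists_forall_le_apply_of_isCompact (hX i) ⟨0, hS⟩
  refine ⟨∑ i, m i, ?_⟩
  rintro _ ⟨y, hy, rfl⟩
  exact (Finset.sum_le_sum fun i _ => hm i (y i) (hy i)).trans
    (le_ciSup (f := fun s => ∑ i, g i s (y i s)) (Set.finite_range _).bddAbove ⟨0, hS⟩)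

/-- Sandwich inequality (equation (15)): if each `x^i ∈ X^i` and `ρ^i` satisfy
`g^i_s(x^i_s) + (Σ_{j∈N_i}(λ^{ij} − λ^{ji}))_s ≤ ρ^i` for all `s`, then
`P* ≤ max_s Σ_i g^i_s(x^i_s) ≤ Σ_i ρ^i`. -/
theorem sandwich_inequality (N S : ℕ) (hN : 0 < N) (hS : 0 < S)
    (X : Fin N → Set (Fin S → ℝ))
    (hXne : ∀ i, (X i).Nonempty)
    (hXconv : ∀ i, Convex ℝ (X i))
    (hXcomp : ∀ i, IsCompact (X i))
    (g : Fin N → Fin S → ℝ → ℝ)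
    (hg : ∀ i s, ConvexOn ℝ Set.univ (g i s))
    (G : SimpleGraph (Fin N)) [DecidableRel G.Adj]
    (lam : Fin N → Fin N → Fin S → ℝ)
    (x : Fin N → Fin S → ℝ) (hx : ∀ i, x i ∈ X i)
    (ρ : Fin N → ℝ)
    (hfeas : ∀ i s, g i s (x i s) + edgeDiff G lam i s ≤ ρ i) :
    sInf (primalSet X g) ≤ (⨆ s : Fin S, ∑ i, g i s (x i s)) ∧
    (⨆ s : Fin S, ∑ i, g i s (x i s)) ≤ ∑ i, ρ i := by
  have : Nonempty (Fin S) := ⟨⟨0, hS⟩⟩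
  refine ⟨csInf_le (bddBelow_primalSet hS hXcomp hg) ⟨x, hx, rfl⟩, ciSup_le fun s => ?_⟩
  have hsum := Finset.sum_le_sum fun i (_ : i ∈ Finset.univ) => hfeas i s
  have hzero : ∑ i, edgeDiff G lam i s = 0 := by
    rw [← Finset.sum_apply, sum_edgeDiff, Pi.zero_apply]
  rwa [Finset.sum_add_distrib, hzero, add_zero] at hsum

end
end
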